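/- Einstein gyrations respect Einstein addition: for all u, v, a, b in the c-ball V_c, gyr[u,v](a ⊕ b) = gyr[u,v]a ⊕ gyr[u,v]b; that is, each gyration is an automorphism of the groupoid (V_c, ⊕). -/

import Mathlib

open scoped RealInnerProductSpace

noncomputable def gamma {V : Type*} [NormedAddCommGroup V] [InnerProductSpace ℝ V]
    (c : ℝ) (u : V) : ℝ :=
  1 / Real.sqrt (1 - ‖u‖ ^ 2 / c ^ 2)

noncomputable def eAdd {V : Type*} [NormedAddCommGroup V] [InnerProductSpace ℝ V]
    (c : ℝ) (u v : V) : V :=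
  (1 / (1 + ⟪u, v⟫ / c ^ 2)) •
    (u + (1 / gamma c u) • v +
      ((1 / c ^ 2) * (gamma c u / (1 + gamma c u)) * ⟪u, v⟫) • u)

noncomputable def eGyr {V : Type*} [NormedAddCommGroup V] [InnerProductSpace ℝ V]
    (c : ℝ) (u v w : V) : V :=
  eAdd c (-(eAdd c u v)) (eAdd c u (eAdd c v w))

noncomputable def eCoadd {V : Type*} [NormedAddCommGroup V] [InnerProductSpace ℝ V]
    (c : ℝ) (u v : V) : V :=
  eAdd c u (eGyr c u (-v) v)

noncomputable def mAdd {V : Type*} [NormedAddCommGroup V] [InnerProductSpace ℝ V]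
    (s : ℝ) (u v : V) : V :=
  (1 / (1 + (2 / s ^ 2) * ⟪u, v⟫ + (1 / s ^ 4) * ‖u‖ ^ 2 * ‖v‖ ^ 2)) •
    ((1 + (2 / s ^ 2) * ⟪u, v⟫ + (1 / s ^ 2) * ‖v‖ ^ 2) • u +
      (1 - (1 / s ^ 2) * ‖u‖ ^ 2) • v)

noncomputable def mGyr {V : Type*} [NormedAddCommGroup V] [InnerProductSpace ℝ V]
    (s : ℝ) (u v w : V) : V :=
  mAdd s (-(mAdd s u v)) (mAdd s u (mAdd s v w))

noncomputable def mCoadd {V : Type*} [NormedAddCommGroup V] [InnerProductSpace ℝ V]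
    (s : ℝ) (u v : V) : V :=
  mAdd s u (mGyr s u (-v) v)

noncomputable def artanh (x : ℝ) : ℝ :=
  (1 / 2) * Real.log ((1 + x) / (1 - x))

open Classical in
noncomputable def sMul {V : Type*} [NormedAddCommGroup V] [InnerProductSpace ℝ V]
    (c : ℝ) (r : ℝ) (v : V) : V :=
  if v = 0 then 0 else (c * Real.tanh (r * artanh (‖v‖ / c)) / ‖v‖) • v

variable {V : Type*} [NormedAddCommGroup V] [InnerProductSpace ℝ V]

/-- The Lorentz boost with velocity `u`, acting on spacetime `ℝ × V`. -/
noncomputable def boost (c : ℝ) (u : V) : ℝ × V →ₗ[ℝ] ℝ × V where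
  toFun p := (gamma c u * (p.1 + ⟪u, p.2⟫ / c ^ 2),
    p.2 + (gamma c u * p.1 + gamma c u ^ 2 / (c ^ 2 * (1 + gamma c u)) * ⟪u, p.2⟫) • u)
  map_add' p q := by
    ext
    · simp only [Prod.fst_add, Prod.snd_add, inner_add_right]
      ring
    · simp only [Prod.fst_add, Prod.snd_add, inner_add_right]
      module
  map_smul' r p := by
    ext
    · simp only [Prod.smul_fst, Prod.smul_snd, inner_smul_right, smul_eq_mul, RingHom.id_apply]
      ring
    · simp only [Prod.smul_fst, Prod.smul_snd, inner_smul_right, smul_eq_mul, RingHom.id_apply]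
      module

/-- The Minkowski form on `ℝ × V`. -/
noncomputable def minkowski (c : ℝ) (p q : ℝ × V) : ℝ :=
  p.1 * q.1 - ⟪p.2, q.2⟫ / c ^ 2

lemma one_sub_norm_sq_div_pos {E : Type*} [NormedAddCommGroup E] {c : ℝ} {u : E} (hu : ‖u‖ < c) :
    0 < 1 - ‖u‖ ^ 2 / c ^ 2 := by
  have hc : 0 < c := (norm_nonneg u).trans_lt hu
  rw [sub_pos, div_lt_one (by positivity)]
  gcongr

lemma gamma_pos {c : ℝ} {u : V} (hu : ‖u‖ < c) : 0 < gamma c u :=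
  one_div_pos.2 (Real.sqrt_pos.2 (one_sub_norm_sq_div_pos hu))

lemma gamma_sq_mul {c : ℝ} {u : V} (hu : ‖u‖ < c) :
    gamma c u ^ 2 * (1 - ‖u‖ ^ 2 / c ^ 2) = 1 := by
  have h := one_sub_norm_sq_div_pos hu
  rw [gamma, div_pow, Real.sq_sqrt h.le, one_pow, one_div_mul_cancel h.ne']

lemma one_add_inner_div_pos {c : ℝ} {u v : V} (hu : ‖u‖ < c) (hv : ‖v‖ < c) :
    0 < 1 + ⟪u, v⟫ / c ^ 2 := by
  have hc : 0 < c := (norm_nonneg u).trans_lt hu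
  have h₁ := neg_le_of_abs_le (abs_real_inner_le_norm u v)
  have h₂ : ‖u‖ * ‖v‖ < c * c :=
    mul_lt_mul'' hu hv (norm_nonneg u) (norm_nonneg v)
  have h₃ : 1 + ⟪u, v⟫ / c ^ 2 = (c * c + ⟪u, v⟫) / c ^ 2 := by field_simp
  rw [h₃]
  exact div_pos (by linarith) (by positivity)

lemma minkowski_boost {c : ℝ} {u : V} (hu : ‖u‖ < c) (p q : ℝ × V) :
    minkowski c (boost c u p) (boost c u q) = minkowski c p q := by
  have hc : 0 < c := (norm_nonneg u).trans_lt hu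
  have hg := gamma_pos hu
  have hn : ‖u‖ ^ 2 = c ^ 2 * (gamma c u ^ 2 - 1) / gamma c u ^ 2 := by
    have h := gamma_sq_mul hu
    field_simp at h ⊢
    linarith
  simp only [minkowski, boost, LinearMap.coe_mk, AddHom.coe_mk, inner_add_left, inner_add_right,
    inner_smul_left, inner_smul_right, real_inner_self_eq_norm_sq, hn, conj_trivial,
    real_inner_comm u p.2]
  have hg' : 1 + gamma c u ≠ 0 := by positivity
  field_simp
  ring

lemma boost_one_mk {c : ℝ} {u v : V} (hu : ‖u‖ < c) (hv : ‖v‖ < c) :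
    boost c u (1, v) =
      (gamma c u * (1 + ⟪u, v⟫ / c ^ 2)) • ((1 : ℝ), eAdd c u v) := by
  have hc : 0 < c := (norm_nonneg u).trans_lt hu
  have hg := gamma_pos hu
  have hd := one_add_inner_div_pos hu hv
  ext
  · simp [boost]
  · simp only [boost, LinearMap.coe_mk, AddHom.coe_mk, Prod.smul_snd, eAdd, smul_smul]
    rw [mul_assoc, mul_one_div_cancel hd.ne', mul_one]
    have hg' : 1 + gamma c u ≠ 0 := by positivity
    match_scalars <;> field_simp

lemma norm_eAdd_lt {c : ℝ} {u v : V} (hu : ‖u‖ < c) (hv : ‖v‖ < c) : ‖eAdd c u v‖ < c := by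
  have hc : 0 < c := (norm_nonneg u).trans_lt hu
  have h := minkowski_boost hu (1, v) (1, v)
  have hk : 0 < gamma c u * (1 + ⟪u, v⟫ / c ^ 2) :=
    mul_pos (gamma_pos hu) (one_add_inner_div_pos hu hv)
  rw [boost_one_mk hu hv] at h
  set k := gamma c u * (1 + ⟪u, v⟫ / c ^ 2)
  simp only [minkowski, Prod.smul_fst, Prod.smul_snd, inner_smul_left, inner_smul_right,
    real_inner_self_eq_norm_sq, conj_trivial, smul_eq_mul] at h
  have h' : k ^ 2 * (1 - ‖eAdd c u v‖ ^ 2 / c ^ 2) = 1 - ‖v‖ ^ 2 / c ^ 2 := by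
    linear_combination h
  have h'' := pos_of_mul_pos_right (h' ▸ one_sub_norm_sq_div_pos hv) (sq_nonneg k)
  rw [sub_pos, div_lt_one (by positivity)] at h''
  exact lt_of_pow_lt_pow_left₀ 2 hc.le h''

/-- The linear map on `V` extending the gyration `eGyr c u v`. -/
noncomputable def gyrLinear (c : ℝ) (u v : V) : V →ₗ[ℝ] V :=
  LinearMap.snd ℝ ℝ V ∘ₗ boost c (-eAdd c u v) ∘ₗ boost c u ∘ₗ boost c v ∘ₗ LinearMap.inr ℝ ℝ V

/-- Boosting a rest particle by `v`, then `u`, then back by `u ⊕ v` leaves it at rest. -/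
lemma boost_neg_eAdd_rest {c : ℝ} {u v : V} (hu : ‖u‖ < c) (hv : ‖v‖ < c) :
    boost c (-eAdd c u v) (boost c u (boost c v (1, 0))) = (1, 0) := by
  have hc : 0 < c := (norm_nonneg u).trans_lt hu
  have hw := norm_eAdd_lt hu hv
  have hw' : ‖-eAdd c u v‖ < c := by rwa [norm_neg]
  have h₀ : boost c v (1, 0) = gamma c v • ((1 : ℝ), v) := by
    ext <;> simp [boost]
  have hinv : eAdd c (-eAdd c u v) (eAdd c u v) = 0 := by
    have hg := gamma_pos hw'
    have hg' : 1 + gamma c (-eAdd c u v) ≠ 0 := by positivity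
    have h := gamma_sq_mul hw'
    have hk : -1 + 1 / gamma c (-eAdd c u v) + 1 / c ^ 2 *
        (gamma c (-eAdd c u v) / (1 + gamma c (-eAdd c u v))) * ‖eAdd c u v‖ ^ 2 = 0 := by
      rw [norm_neg] at h
      field_simp at h ⊢
      linear_combination -h
    rw [eAdd.eq_1 c (-eAdd c u v), inner_neg_left, real_inner_self_eq_norm_sq]
    refine smul_eq_zero_of_right _ ?_
    rw [← zero_smul ℝ (eAdd c u v), ← hk]
    module
  have hG : ∃ k : ℝ, 0 < k ∧
      boost c (-eAdd c u v) (boost c u (boost c v (1, 0))) = k • ((1 : ℝ), (0 : V)) := by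
    refine ⟨_, ?_, by
      rw [h₀, map_smul, boost_one_mk hu hv, map_smul, map_smul, boost_one_mk hw' hw, hinv,
        smul_smul, smul_smul]⟩
    have := gamma_pos hu
    have := gamma_pos hv
    have := gamma_pos hw'
    have := one_add_inner_div_pos hu hv
    have := one_add_inner_div_pos hw' hw
    positivity
  obtain ⟨k, hk, hG⟩ := hG
  have hQ : minkowski c (k • ((1 : ℝ), (0 : V))) (k • ((1 : ℝ), (0 : V))) =
      minkowski c ((1 : ℝ), (0 : V)) (1, 0) := by
    rw [← hG, minkowski_boost hw', minkowski_boost hu, minkowski_boost hv]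
  have hk1 : k = 1 := by
    simp only [minkowski, Prod.smul_mk, smul_eq_mul, mul_one, smul_zero, inner_zero_left,
      zero_div, sub_zero] at hQ
    nlinarith
  rw [hG, hk1, one_smul]

lemma boost_neg_eAdd_mk {c : ℝ} {u v : V} (hu : ‖u‖ < c) (hv : ‖v‖ < c) (t : ℝ) (x : V) :
    boost c (-eAdd c u v) (boost c u (boost c v (t, x))) = (t, gyrLinear c u v x) := by
  have hw' : ‖-eAdd c u v‖ < c := by
    rw [norm_neg]
    exact norm_eAdd_lt hu hv
  have hsplit : (t, x) = t • ((1 : ℝ), (0 : V)) + (0, x) := by simp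
  have hrest := boost_neg_eAdd_rest hu hv
  have htime : (boost c (-eAdd c u v) (boost c u (boost c v (0, x)))).1 = 0 := by
    have h : minkowski c (boost c (-eAdd c u v) (boost c u (boost c v (0, x)))) (1, 0) =
        minkowski c (0, x) ((1 : ℝ), (0 : V)) := by
      conv_lhs => rw [← hrest]
      rw [minkowski_boost hw', minkowski_boost hu, minkowski_boost hv]
    simpa [minkowski] using h
  rw [hsplit, map_add, map_add, map_add, map_smul, map_smul, map_smul, hrest]
  ext
  · simp [htime]
  · simp [gyrLinear]

lemma inner_gyrLinear {c : ℝ} {u v : V} (hu : ‖u‖ < c) (hv : ‖v‖ < c) (x y : V) :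
    ⟪gyrLinear c u v x, gyrLinear c u v y⟫ = ⟪x, y⟫ := by
  have hc : 0 < c := (norm_nonneg u).trans_lt hu
  have hw' : ‖-eAdd c u v‖ < c := by
    rw [norm_neg]
    exact norm_eAdd_lt hu hv
  have h : minkowski c ((0 : ℝ), gyrLinear c u v x) (0, gyrLinear c u v y) =
      minkowski c ((0 : ℝ), x) (0, y) := by
    rw [← boost_neg_eAdd_mk hu hv, ← boost_neg_eAdd_mk hu hv, minkowski_boost hw',
      minkowski_boost hu, minkowski_boost hv]
  simp only [minkowski] at h
  field_simp at h
  linarith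

lemma eGyr_eq_gyrLinear {c : ℝ} {u v w : V} (hu : ‖u‖ < c) (hv : ‖v‖ < c) (hw : ‖w‖ < c) :
    eGyr c u v w = gyrLinear c u v w := by
  have hvw := norm_eAdd_lt hv hw
  have huvw := norm_eAdd_lt hu hvw
  have hn : ‖-eAdd c u v‖ < c := by
    rw [norm_neg]
    exact norm_eAdd_lt hu hv
  have h := boost_neg_eAdd_mk hu hv 1 w
  rw [boost_one_mk hv hw, map_smul, boost_one_mk hu hvw, map_smul, map_smul,
    boost_one_mk hn huvw, smul_smul, smul_smul, Prod.smul_mk, Prod.mk.injEq, smul_eq_mul,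
    mul_one] at h
  rw [h.1, one_smul] at h
  exact h.2

lemma LinearIsometry.map_eAdd (f : V →ₗᵢ[ℝ] V) (c : ℝ) (a b : V) :
    f (eAdd c a b) = eAdd c (f a) (f b) := by
  simp only [eAdd, gamma, map_smul, map_add, f.inner_map_map, f.norm_map]

theorem einstein_gyr_automorphism (c : ℝ) (hc : 0 < c) (u v a b : V)
    (hu : ‖u‖ < c) (hv : ‖v‖ < c) (ha : ‖a‖ < c) (hb : ‖b‖ < c) :
    eGyr c u v (eAdd c a b) = eAdd c (eGyr c u v a) (eGyr c u v b) := by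
  rw [eGyr_eq_gyrLinear hu hv (norm_eAdd_lt ha hb), eGyr_eq_gyrLinear hu hv ha,
    eGyr_eq_gyrLinear hu hv hb]
  exact ((gyrLinear c u v).isometryOfInner (inner_gyrLinear hu hv)).map_eAdd c a b
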